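/- There exist K ≥ 10 and C > 0, depending only on the Schottky data, such that for every h ∈ (0,1], every ν ∈ [0,1/2], setting s := 1/2 − ν + i/h, and every function u continuous on D, holomorphic on the interior of D, and satisfying L_s u = u on the interior of D: sup over z ∈ D of e^{−K|Im z|/h} |u(z)| ≤ C · sup over x ∈ I of |u(x)|. -/

import Mathlib

open Complex MeasureTheory Metric Set
open scoped Real

noncomputable section


abbrev SL2R := Matrix.SpecialLinearGroup (Fin 2) ℝ

/-- Entries of a matrix in `SL(2,ℝ)`, as complex numbers. -/
def mA (g : SL2R) : ℂ := ((g.1 0 0 : ℝ) : ℂ)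
def mB (g : SL2R) : ℂ := ((g.1 0 1 : ℝ) : ℂ)
def mC (g : SL2R) : ℂ := ((g.1 1 0 : ℝ) : ℂ)
def mD (g : SL2R) : ℂ := ((g.1 1 1 : ℝ) : ℂ)

/-- The Möbius action of `SL(2,ℝ)` on the Riemann sphere `ℂ ∪ {∞}`. -/
def moebius (g : SL2R) : OnePoint ℂ → OnePoint ℂ := fun z =>
  match z with
  | OnePoint.infty => if mC g = 0 then OnePoint.infty else ((mA g / mC g : ℂ) : OnePoint ℂ)
  | (w : ℂ) => if mC g * w + mD g = 0 then OnePoint.infty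
      else (((mA g * w + mB g) / (mC g * w + mD g) : ℂ) : OnePoint ℂ)

/-- The Möbius action on `ℂ`, with junk value at the pole. -/
def moebiusC (g : SL2R) (z : ℂ) : ℂ := (mA g * z + mB g) / (mC g * z + mD g)

/-- The Möbius action on `ℝ`, with junk value at the pole. -/
def moebiusR (g : SL2R) (x : ℝ) : ℝ :=
  (g.1 0 0 * x + g.1 0 1) / (g.1 1 0 * x + g.1 1 1)

/-- The complex derivative `γ'(z) = (cz+d)⁻²` of a Möbius transformation (`det = 1`). -/
def dMob (g : SL2R) (z : ℂ) : ℂ := ((mC g * z + mD g)⁻¹) ^ 2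

/-- The involution `a ↦ ā` on the alphabet `{1, …, 2r}` (as `Fin (2*r)`). -/
def bar {r : ℕ} (a : Fin (2 * r)) : Fin (2 * r) :=
  if h : (a : ℕ) < r then ⟨(a : ℕ) + r, by omega⟩
  else ⟨(a : ℕ) - r, by have := a.isLt; omega⟩

/-- Schottky data: `2r` pairwise disjoint closed disks centered on the real axis and
`2r` elements of `SL(2,ℝ)` with `γ_a((ℂ∪{∞}) \ interior D_{ā}) = D_a`, `γ_ā = γ_a⁻¹`. -/
structure Schottky (r : ℕ) where
  hr : 1 ≤ r
  center : Fin (2 * r) → ℝ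
  radius : Fin (2 * r) → ℝ
  radius_pos : ∀ a, 0 < radius a
  disj : Pairwise fun a b =>
    Disjoint (closedBall ((center a : ℝ) : ℂ) (radius a)) (closedBall ((center b : ℝ) : ℂ) (radius b))
  γ : Fin (2 * r) → SL2R
  γ_bar : ∀ a, γ (bar a) = (γ a)⁻¹
  γ_maps : ∀ a, moebius (γ a) ''
      (univ \ ((fun z : ℂ => (z : OnePoint ℂ)) '' interior (closedBall ((center (bar a) : ℝ) : ℂ) (radius (bar a)))))
    = (fun z : ℂ => (z : OnePoint ℂ)) '' closedBall ((center a : ℝ) : ℂ) (radius a)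

/-- Words: finite sequences of letters with `a_{j+1} ≠ ā_j`. -/
def IsWord {r : ℕ} (w : List (Fin (2 * r))) : Prop := w.Chain' fun x y => y ≠ bar x

/-- The word `ā := ā_n ⋯ ā_1`. -/
def barWord {r : ℕ} (w : List (Fin (2 * r))) : List (Fin (2 * r)) := (w.map bar).reverse

namespace Schottky

variable {r : ℕ} (S : Schottky r)

/-- The disk `D_a` for a letter `a`. -/
def disk (a : Fin (2 * r)) : Set ℂ := closedBall ((S.center a : ℝ) : ℂ) (S.radius a)

/-- `γ_w := γ_{a_1} ⋯ γ_{a_n}`. -/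
def g (w : List (Fin (2 * r))) : SL2R := (w.map S.γ).prod

/-- The disk `D_w := γ_{w'}(D_{a_n})` of a nonempty word, as a subset of the Riemann sphere. -/
def sdisk : List (Fin (2 * r)) → Set (OnePoint ℂ)
  | [] => ∅
  | a :: w => moebius (S.g ((a :: w).dropLast)) ''
      ((fun z : ℂ => (z : OnePoint ℂ)) '' S.disk ((a :: w).getLast (List.cons_ne_nil a w)))

/-- The disk `D_w` as a subset of `ℂ`. -/
def wdisk (w : List (Fin (2 * r))) : Set ℂ := {z : ℂ | (z : OnePoint ℂ) ∈ S.sdisk w}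

/-- The interval `I_w = D_w ∩ ℝ`, as a subset of `ℝ`. -/
def wint (w : List (Fin (2 * r))) : Set ℝ := {x : ℝ | ((x : ℝ) : ℂ) ∈ S.wdisk w}

/-- The length `|I_w|` of the interval `I_w`. -/
def wlen (w : List (Fin (2 * r))) : ℝ := Metric.diam (S.wint w)

/-- `D = ⋃_{a ∈ A} D_a`. -/
def D : Set ℂ := ⋃ a, S.disk a

/-- `I = D ∩ ℝ`, as a subset of `ℝ`. -/
def Ire : Set ℝ := {x : ℝ | ((x : ℝ) : ℂ) ∈ S.D}

/-- `D₂ = ⋃_{|w| = 2} D_w`. -/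
def D₂ : Set ℂ := ⋃ (a : Fin (2 * r)), ⋃ (b : Fin (2 * r)), ⋃ (_ : b ≠ bar a), S.wdisk [a, b]

/-- `I'_a` for a letter `a`: the convex hull of `⋃_{b ≠ ā} I_{ab}`. -/
def iprimeLetter (a : Fin (2 * r)) : Set ℝ :=
  convexHull ℝ (⋃ (b : Fin (2 * r)), ⋃ (_ : b ≠ bar a), S.wint [a, b])

/-- `I'_w := γ_{w'}(I'_{a_n})` for a nonempty word `w`. -/
def iprime : List (Fin (2 * r)) → Set ℝ
  | [] => ∅
  | a :: w => moebiusR (S.g ((a :: w).dropLast)) ''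
      S.iprimeLetter ((a :: w).getLast (List.cons_ne_nil a w))

/-- The partition `Z(τ)`. -/
def Ztau (τ : ℝ) : Set (List (Fin (2 * r))) :=
  {w | w ≠ [] ∧ IsWord w ∧ S.wlen w ≤ τ ∧ (w.dropLast = [] ∨ τ < S.wlen w.dropLast)}

/-- The limit set `Λ_Γ ⊂ ℝ`. -/
def limitSet : Set ℝ :=
  {x : ℝ | ∀ n : ℕ, 1 ≤ n → ∃ w : List (Fin (2 * r)), IsWord w ∧ w.length = n ∧ x ∈ S.wint w}

/-- The τ-neighbourhood `Λ_Γ(τ) ⊂ ℝ` of the limit set. -/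
def limitSetNbhd (τ : ℝ) : Set ℝ := {x : ℝ | ∃ y ∈ S.limitSet, |x - y| ≤ τ}

end Schottky

/-- `ℓ` is a holomorphic branch on `U` of the logarithm of the derivative of the Möbius
transformation of `g`, real on `U ∩ ℝ`. -/
structure IsLogBranch (g : SL2R) (U : Set ℂ) (ℓ : ℂ → ℂ) : Prop where
  holo : DifferentiableOn ℂ ℓ U
  exp_eq : ∀ z ∈ U, Complex.exp (ℓ z) = dMob g z
  real_on : ∀ x : ℝ, ((x : ℝ) : ℂ) ∈ U → (ℓ ((x : ℝ) : ℂ)).im = 0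

/-- A family of branches `ℓ a b` of `log γ_a'` on `D_b`, for all `a ≠ b̄`. -/
def IsBranchFamily {r : ℕ} (S : Schottky r) (ℓ : Fin (2 * r) → Fin (2 * r) → ℂ → ℂ) : Prop :=
  ∀ a b : Fin (2 * r), a ≠ bar b → IsLogBranch (S.γ a) (S.disk b) (ℓ a b)

/-- The fixed-point equation `L_s u = u` on the interior of `D`, written pointwise. -/
def TransferFixed {r : ℕ} (S : Schottky r) (s : ℂ)
    (ℓ : Fin (2 * r) → Fin (2 * r) → ℂ → ℂ) (u : ℂ → ℂ) : Prop :=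
  ∀ b : Fin (2 * r), ∀ z ∈ interior (S.disk b),
    u z = ∑ a : Fin (2 * r), if a ≠ bar b then
      Complex.exp (s * ℓ a b z) * u (moebiusC (S.γ a) z) else 0

/-- The transfer operator `L_s`, as an operator on functions. -/
def transferOp {r : ℕ} (S : Schottky r) (s : ℂ)
    (ℓ : Fin (2 * r) → Fin (2 * r) → ℂ → ℂ) (u : ℂ → ℂ) : ℂ → ℂ := fun z =>
  ∑ b : Fin (2 * r), (S.disk b).indicator
    (fun w => ∑ a : Fin (2 * r), if a ≠ bar b then
      Complex.exp (s * ℓ a b w) * u (moebiusC (S.γ a) w) else 0) z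

/-- A partition: a finite set of nonempty words such that every long enough word
has exactly one prefix in it. -/
def IsPartition {r : ℕ} (S : Schottky r) (Z : Finset (List (Fin (2 * r)))) : Prop :=
  (∀ w ∈ Z, w ≠ [] ∧ IsWord w) ∧
  ∃ N : ℕ, ∀ w : List (Fin (2 * r)), IsWord w → N ≤ w.length →
    ∃! p : List (Fin (2 * r)), p ∈ Z ∧ p <+: w



/-- The angle-type weight of a disk of radius `ρ` about the real point `c`; inside the disk it is
`|arg ((z - c + ρ) / (ρ - (z - c)))|`. -/
def angleWeight (c ρ : ℝ) (z : ℂ) : ℝ :=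
  Real.arctan (2 * ρ * |z.im| / (ρ ^ 2 - ‖z - c‖ ^ 2))

lemma cayley_re_pos {v : ℂ} {ρ : ℝ} (hv : ‖v‖ < ρ) :
    0 < ((v + ρ) / (ρ - v)).re ∧ (ρ : ℂ) - v ≠ 0 ∧
    Complex.arg ((v + ρ) / (ρ - v)) = Real.arctan (2 * ρ * v.im / (ρ ^ 2 - ‖v‖ ^ 2)) := by
  have hne : (ρ : ℂ) - v ≠ 0 := by
    intro h
    rw [sub_eq_zero] at h
    rw [← h, Complex.norm_real] at hv
    exact absurd hv (not_lt.mpr (le_abs_self ρ))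
  have hN : 0 < Complex.normSq ((ρ : ℂ) - v) := Complex.normSq_pos.mpr hne
  have hpos : 0 < ρ ^ 2 - ‖v‖ ^ 2 := by nlinarith [norm_nonneg v]
  have hre : ((v + ρ) / (ρ - v)).re = (ρ ^ 2 - ‖v‖ ^ 2) / Complex.normSq ((ρ : ℂ) - v) := by
    rw [Complex.div_re, ← Complex.normSq_eq_norm_sq, ← add_div]
    congr 1
    simp [Complex.normSq_apply]
    ring
  have him : ((v + ρ) / (ρ - v)).im = (2 * ρ * v.im) / Complex.normSq ((ρ : ℂ) - v) := by
    rw [Complex.div_im, ← sub_div]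
    congr 1
    simp
    ring
  have hre0 : 0 < ((v + ρ) / (ρ - v)).re := by rw [hre]; positivity
  refine ⟨hre0, hne, ?_⟩
  have harg := Complex.abs_arg_lt_pi_div_two_iff.mpr (Or.inl hre0)
  rw [abs_lt] at harg
  rw [← Real.arctan_tan harg.1 harg.2, Complex.tan_arg, hre, him]
  congr 1
  field_simp

lemma angleWeight_eq {c ρ σ : ℝ} {z : ℂ} (hz : ‖z - c‖ < ρ) (hσ : σ = 1 ∨ σ = -1)
    (hy : 0 ≤ σ * z.im) :
    angleWeight c ρ z = σ * (Complex.log ((z - c + ρ) / (ρ - (z - c)))).im := by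
  have habs : |z.im| = σ * z.im := by
    rcases hσ with rfl | rfl
    · rw [abs_of_nonneg (by linarith)]; ring
    · rw [abs_of_nonpos (by linarith)]; ring
  rw [Complex.log_im, (cayley_re_pos hz).2.2, angleWeight, habs]
  rcases hσ with rfl | rfl
  · simp
  · rw [neg_one_mul, neg_one_mul, ← Real.arctan_neg]
    congr 1
    simp
    ring

lemma angleWeight_of_im_eq_zero {c ρ : ℝ} {z : ℂ} (hz : z.im = 0) : angleWeight c ρ z = 0 := by
  simp [angleWeight, hz]

lemma continuousOn_angleWeight {c R ρ : ℝ} (hR : 0 < R) (hρ : R < ρ) :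
    ContinuousOn (angleWeight c ρ) (closedBall (c : ℂ) R) := by
  refine Real.continuous_arctan.comp_continuousOn (ContinuousOn.div ?_ ?_ ?_)
  · exact (continuous_const.mul (continuous_abs.comp Complex.continuous_im)).continuousOn
  · fun_prop
  · intro z hz
    rw [mem_closedBall_iff_norm] at hz
    nlinarith [norm_nonneg (z - (c : ℂ))]

lemma norm_mul_exp_angleWeight_le_of_half {c R ρ t k M m σ : ℝ} (n : ℕ) {u : ℂ → ℂ} (hR : 0 < R)
    (hρ : R < ρ) (ht : 0 < t) (hσ : σ = 1 ∨ σ = -1)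
    (hu : ContinuousOn u (closedBall (c : ℂ) R)) (hd : DifferentiableOn ℂ u (ball (c : ℂ) R))
    (hM : ∀ z ∈ closedBall (c : ℂ) R, Real.exp (-(k * angleWeight c ρ z)) * ‖u z‖ ≤ M)
    (hm : ∀ x : ℝ, (x : ℂ) ∈ closedBall (c : ℂ) R → ‖u x‖ ≤ m)
    {z : ℂ} (hz : z ∈ ball (c : ℂ) R) (hy : 0 < σ * z.im) :
    Real.exp (-(k * angleWeight c ρ z)) * ‖u z‖
      ≤ max M (m * (R / t) ^ n) * ((‖z - c‖ + t) / R) ^ n := by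
  have hm0 : 0 ≤ m := (norm_nonneg _).trans (hm c (by simp [hR.le]))
  have hσ2 : σ * σ = 1 := by rcases hσ with rfl | rfl <;> norm_num
  set w : ℂ := c - I * (σ * t) with hw
  have hwim : ∀ z : ℂ, σ * (z - w).im = σ * z.im + t := by
    intro z
    simp [hw]
    linear_combination t * hσ2
  have hzw : ∀ z : ℂ, 0 ≤ σ * z.im → t ≤ ‖z - w‖ := by
    intro z hz
    have h1 := Complex.abs_im_le_norm (z - w)
    have h2 : σ * (z - w).im ≤ |(z - w).im| := by
      rcases hσ with rfl | rfl
      · rw [one_mul]; exact le_abs_self _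
      · rw [neg_one_mul]; exact neg_le_abs _
    linarith [hwim z]
  set U : Set ℂ := ball (c : ℂ) R ∩ {z | 0 < σ * z.im} with hU
  have hUo : IsOpen U := isOpen_ball.inter
    (isOpen_lt continuous_const (continuous_const.mul Complex.continuous_im))
  have hcl : closure U ⊆ closedBall (c : ℂ) R ∩ {z | 0 ≤ σ * z.im} := by
    refine closure_minimal ?_ (isClosed_closedBall.inter
      (isClosed_le continuous_const (continuous_const.mul Complex.continuous_im)))
    rintro x ⟨hx1, hx2⟩
    exact ⟨ball_subset_closedBall hx1, (show 0 < σ * x.im from hx2).le⟩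
  set f : ℂ → ℂ := fun z => u z * Complex.exp (I * (σ * k) *
    Complex.log ((z - c + ρ) / (ρ - (z - c)))) * (R / (z - w)) ^ n with hf
  have hlt : ∀ z ∈ closedBall (c : ℂ) R, ‖z - c‖ < ρ := fun z hz =>
    (mem_closedBall_iff_norm.mp hz).trans_lt hρ
  have hfn : ∀ z ∈ closedBall (c : ℂ) R, 0 ≤ σ * z.im →
      ‖f z‖ = Real.exp (-(k * angleWeight c ρ z)) * ‖u z‖ * (R / ‖z - w‖) ^ n := by
    intro z hz hy
    rw [angleWeight_eq (hlt z hz) hσ hy]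
    simp only [hf, norm_mul, norm_pow, norm_div, Complex.norm_exp, Complex.norm_real,
      Real.norm_of_nonneg hR.le]
    rw [mul_comm ‖u z‖]
    congr 4
    simp
    ring
  have hwne : ∀ z : ℂ, 0 ≤ σ * z.im → z - w ≠ 0 := fun z hz =>
    norm_pos_iff.mp (ht.trans_le (hzw z hz))
  have hE : DifferentiableOn ℂ (fun z : ℂ => Complex.exp (I * (σ * k) *
      Complex.log ((z - c + ρ) / (ρ - (z - c)))) * (R / (z - w)) ^ n) (closure U) := by
    intro z hz
    obtain ⟨hz1, hz2⟩ := hcl hz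
    have hc := cayley_re_pos (hlt z hz1)
    apply DifferentiableAt.differentiableWithinAt
    have h1 : DifferentiableAt ℂ (fun z : ℂ => (z - c + ρ) / (ρ - (z - c))) z := by
      refine DifferentiableAt.div (by fun_prop) (by fun_prop) hc.2.1
    have h2 := h1.clog (Or.inl hc.1)
    have h3 : DifferentiableAt ℂ (fun z : ℂ => (R : ℂ) / (z - w)) z :=
      DifferentiableAt.div (by fun_prop) (by fun_prop) (hwne z hz2)
    exact ((h2.const_mul _).cexp).mul (h3.pow n)
  have hdc : DiffContOnCl ℂ f U := by
    constructor
    · have := (hd.mono (inter_subset_left : U ⊆ _)).mul (hE.mono subset_closure)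
      refine this.congr fun z _ => ?_
      simp only [hf, Pi.mul_apply, mul_assoc]
    · have := (hu.mono (fun z hz => (hcl hz).1)).mul hE.continuousOn
      refine this.congr fun z _ => ?_
      simp only [hf, Pi.mul_apply, mul_assoc]
  have hbd : Bornology.IsBounded U := isBounded_ball.subset inter_subset_left
  have hfr : ∀ z ∈ frontier U, ‖f z‖ ≤ max M (m * (R / t) ^ n) := by
    intro z hz
    rw [hUo.frontier_eq] at hz
    obtain ⟨hz1, hz2⟩ := hcl hz.1
    have hz2' : 0 ≤ σ * z.im := hz2
    rw [hfn z hz1 hz2]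
    have hpos := ht.trans_le (hzw z hz2)
    rcases hz2'.lt_or_eq with hlt | heq
    · refine le_max_of_le_left ?_
      have hzs : R ≤ ‖z - c‖ := by
        by_contra! hcon
        exact hz.2 ⟨mem_ball_iff_norm.mpr hcon, hlt⟩
      have hRw : R ≤ ‖z - w‖ := by
        refine hzs.trans ?_
        rw [← sq_le_sq₀ (norm_nonneg _) (norm_nonneg _), ← Complex.normSq_eq_norm_sq,
          ← Complex.normSq_eq_norm_sq, Complex.normSq_apply, Complex.normSq_apply]
        simp [hw]
        nlinarith [mul_pos ht hlt, mul_pos ht ht]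
      refine (mul_le_of_le_one_right (by positivity) ?_).trans (hM z hz1)
      exact pow_le_one₀ (by positivity) (div_le_one_of_le₀ hRw (norm_nonneg _))
    · refine le_max_of_le_right ?_
      have him : z.im = 0 := by
        rcases hσ with rfl | rfl <;> linarith
      have hzr : z = (z.re : ℂ) := Complex.ext rfl (by simpa using him)
      rw [angleWeight_of_im_eq_zero him]
      have hum : ‖u z‖ ≤ m := by
        rw [hzr]; exact hm _ (by rw [← hzr]; exact hz1)
      simp only [mul_zero, neg_zero, Real.exp_zero, one_mul]
      gcongr
      exact hzw z hz2
  have hzU : z ∈ U := ⟨hz, hy⟩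
  have hmax := Complex.norm_le_of_forall_mem_frontier_norm_le hbd hdc hfr (subset_closure hzU)
  rw [hfn z (ball_subset_closedBall hz) hy.le] at hmax
  have hpos := ht.trans_le (hzw z hy.le)
  have hle : ‖z - w‖ ≤ ‖z - c‖ + t := by
    have : z - w = (z - c) + I * (σ * t) := by rw [hw]; ring
    rw [this]
    refine (norm_add_le _ _).trans ?_
    have hσn : |σ| = 1 := by rcases hσ with rfl | rfl <;> norm_num
    simp [hσn, abs_of_pos ht]
  calc Real.exp (-(k * angleWeight c ρ z)) * ‖u z‖
      = Real.exp (-(k * angleWeight c ρ z)) * ‖u z‖ * (R / ‖z - w‖) ^ n * (‖z - w‖ / R) ^ n := by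
        rw [mul_assoc, ← mul_pow, div_mul_div_cancel₀ hpos.ne', div_self hR.ne', one_pow, mul_one]
    _ ≤ _ := by
        gcongr

/-- Maximum principle on the two halves of a disk: a weighted bound improves geometrically away
from the boundary circle, at the cost of the values on the real axis. -/
lemma norm_mul_exp_angleWeight_le {c R ρ t k M m : ℝ} (n : ℕ) {u : ℂ → ℂ} (hR : 0 < R)
    (hρ : R < ρ) (ht : 0 < t)
    (hu : ContinuousOn u (closedBall (c : ℂ) R)) (hd : DifferentiableOn ℂ u (ball (c : ℂ) R))
    (hM : ∀ z ∈ closedBall (c : ℂ) R, Real.exp (-(k * angleWeight c ρ z)) * ‖u z‖ ≤ M)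
    (hm : ∀ x : ℝ, (x : ℂ) ∈ closedBall (c : ℂ) R → ‖u x‖ ≤ m)
    {z : ℂ} (hz : z ∈ ball (c : ℂ) R) :
    Real.exp (-(k * angleWeight c ρ z)) * ‖u z‖
      ≤ max M (m * (R / t) ^ n) * ((‖z - c‖ + t) / R) ^ n := by
  rcases lt_trichotomy z.im 0 with h | h | h
  · exact norm_mul_exp_angleWeight_le_of_half n hR hρ ht (Or.inr rfl) hu hd hM hm hz (by linarith)
  · have hzr : z = (z.re : ℂ) := Complex.ext rfl (by simpa using h)
    have hum : ‖u z‖ ≤ m := by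
      rw [hzr]; exact hm _ (by rw [← hzr]; exact ball_subset_closedBall hz)
    have hm0 := (norm_nonneg _).trans hum
    rw [angleWeight_of_im_eq_zero h]
    simp only [mul_zero, neg_zero, Real.exp_zero, one_mul]
    calc ‖u z‖ ≤ m * ((‖z - c‖ + t) / t) ^ n := by
          refine hum.trans (le_mul_of_one_le_right hm0 (one_le_pow₀ ?_))
          rw [le_div_iff₀ ht]
          linarith [norm_nonneg (z - (c : ℂ))]
      _ = m * (R / t) ^ n * ((‖z - c‖ + t) / R) ^ n := by
          rw [mul_assoc, ← mul_pow]
          congr 2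
          field_simp
      _ ≤ _ := by gcongr; exact le_max_right _ _
  · exact norm_mul_exp_angleWeight_le_of_half n hR hρ ht (Or.inl rfl) hu hd hM hm hz (by linarith)

lemma bar_bar {r : ℕ} (a : Fin (2 * r)) : bar (bar a) = a := by
  have := a.isLt
  ext
  by_cases h : (a : ℕ) < r
  · simp [bar, h]
  · have h2 : (a : ℕ) - r < r := by omega
    simp [bar, h, h2]
    omega

lemma moebius_coe_of_ne {g : SL2R} {z : ℂ} (hz : mC g * z + mD g ≠ 0) :
    moebius g (z : OnePoint ℂ) = (moebiusC g z : OnePoint ℂ) := by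
  change (if mC g * z + mD g = 0 then OnePoint.infty else _) = _
  rw [if_neg hz]
  rfl

lemma moebius_coe_of_eq {g : SL2R} {z : ℂ} (hz : mC g * z + mD g = 0) :
    moebius g (z : OnePoint ℂ) = OnePoint.infty := by
  change (if mC g * z + mD g = 0 then OnePoint.infty else _) = _
  rw [if_pos hz]

lemma SL2R.det_eq (g : SL2R) : g.1 0 0 * g.1 1 1 - g.1 0 1 * g.1 1 0 = 1 := by
  have := g.2
  rwa [Matrix.det_fin_two] at this

lemma mA_mul_mD_sub (g : SL2R) : mA g * mD g - mB g * mC g = 1 := by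
  have := SL2R.det_eq g
  simp only [mA, mB, mC, mD]
  exact_mod_cast this

lemma moebius_injective (g : SL2R) {z : ℂ} {p : OnePoint ℂ}
    (hz : mC g * z + mD g ≠ 0) (h : moebius g p = moebius g (z : OnePoint ℂ)) :
    p = (z : OnePoint ℂ) := by
  have hdet := mA_mul_mD_sub g
  rw [moebius_coe_of_ne hz] at h
  induction p using OnePoint.rec with
  | infty =>
    exfalso
    change (if mC g = 0 then OnePoint.infty else ((mA g / mC g : ℂ) : OnePoint ℂ)) = _ at h
    split_ifs at h with hc
    · exact OnePoint.infty_ne_coe _ h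
    · rw [OnePoint.coe_eq_coe, moebiusC, div_eq_div_iff hc hz] at h
      have : (1 : ℂ) = 0 := by linear_combination h - hdet
      exact one_ne_zero this
  | coe w =>
    by_cases hw : mC g * w + mD g = 0
    · rw [moebius_coe_of_eq hw] at h
      exact absurd h (OnePoint.infty_ne_coe _)
    · rw [moebius_coe_of_ne hw, OnePoint.coe_eq_coe, moebiusC, moebiusC, div_eq_div_iff hw hz] at h
      rw [OnePoint.coe_eq_coe]
      linear_combination h - (w - z) * hdet

/-- A real quadratic that is nonnegative exactly off an open interval vanishes at its endpoints. -/
lemma quadratic_eq_of_sign {α β δ c R : ℝ} (hR : 0 < R)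
    (hout : ∀ x : ℝ, R ≤ |x - c| → 0 ≤ α * x ^ 2 + β * x + δ)
    (hin : ∀ x : ℝ, |x - c| < R → α * x ^ 2 + β * x + δ < 0) :
    0 < α ∧ β = -2 * α * c ∧ δ = α * (c ^ 2 - R ^ 2) := by
  have hcont : Continuous fun x : ℝ => α * x ^ 2 + β * x + δ := by fun_prop
  have hle : ∀ x ∈ closedBall c R, α * x ^ 2 + β * x + δ ≤ 0 := by
    intro x hx
    rw [← closure_ball c hR.ne'] at hx
    refine closure_minimal (t := {x | α * x ^ 2 + β * x + δ ≤ 0}) ?_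
      (isClosed_le hcont continuous_const) hx
    intro y hy
    exact (hin y (by simpa [Real.dist_eq] using hy)).le
  have h1 : α * (c + R) ^ 2 + β * (c + R) + δ = 0 :=
    le_antisymm (hle _ (by simp [abs_of_pos hR]))
      (hout _ (by simp [abs_of_pos hR]))
  have h2 : α * (c - R) ^ 2 + β * (c - R) + δ = 0 :=
    le_antisymm (hle _ (by simp [abs_of_pos hR]))
      (hout _ (by simp [abs_of_pos hR]))
  have h3 := hin c (by simpa using hR)
  have hβ : β = -2 * α * c := by
    have : R * (β + 2 * α * c) = 0 := by linear_combination (h1 - h2) / 2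
    rcases mul_eq_zero.mp this with h | h
    · exact absurd h hR.ne'
    · linarith
  have hδ : δ = α * (c ^ 2 - R ^ 2) := by
    subst hβ
    linear_combination (h1 + h2) / 2
  refine ⟨?_, hβ, hδ⟩
  subst hβ hδ
  have : 0 < α * R ^ 2 := by nlinarith
  exact pos_of_mul_pos_left this (by positivity)

namespace Schottky

variable {r : ℕ} (S : Schottky r)

lemma denom_ne_zero (a : Fin (2 * r)) {z : ℂ} (hz : S.radius (bar a) ≤ ‖z - S.center (bar a)‖) :
    mC (S.γ a) * z + mD (S.γ a) ≠ 0 := by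
  intro h
  have hmem : moebius (S.γ a) (z : OnePoint ℂ) ∈
      (fun z : ℂ => (z : OnePoint ℂ)) '' closedBall ((S.center a : ℝ) : ℂ) (S.radius a) := by
    rw [← S.γ_maps a]
    refine mem_image_of_mem _ ⟨mem_univ _, ?_⟩
    rintro ⟨w, hw, hwz⟩
    rw [OnePoint.coe_eq_coe] at hwz
    subst hwz
    rw [interior_closedBall _ (S.radius_pos _).ne', mem_ball_iff_norm] at hw
    linarith
  rw [moebius_coe_of_eq h] at hmem
  obtain ⟨w, -, hw⟩ := hmem
  exact OnePoint.coe_ne_infty _ hw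

lemma moebiusC_mem_iff (a : Fin (2 * r)) {z : ℂ} (hz : mC (S.γ a) * z + mD (S.γ a) ≠ 0) :
    ‖moebiusC (S.γ a) z - S.center a‖ ≤ S.radius a ↔
      S.radius (bar a) ≤ ‖z - S.center (bar a)‖ := by
  have key : moebius (S.γ a) (z : OnePoint ℂ) ∈
      (fun z : ℂ => (z : OnePoint ℂ)) '' closedBall ((S.center a : ℝ) : ℂ) (S.radius a) ↔
      S.radius (bar a) ≤ ‖z - S.center (bar a)‖ := by
    rw [← S.γ_maps a, interior_closedBall _ (S.radius_pos _).ne']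
    constructor
    · rintro ⟨p, ⟨-, hp⟩, hpz⟩
      rw [moebius_injective _ hz hpz] at hp
      by_contra! hcon
      exact hp ⟨z, mem_ball_iff_norm.mpr hcon, rfl⟩
    · intro h
      refine mem_image_of_mem _ ⟨mem_univ _, ?_⟩
      rintro ⟨w, hw, hwz⟩
      rw [OnePoint.coe_eq_coe] at hwz
      subst hwz
      rw [mem_ball_iff_norm] at hw
      linarith
  rw [← key, moebius_coe_of_ne hz]
  constructor
  · intro h
    exact ⟨_, mem_closedBall_iff_norm.mpr h, rfl⟩
  · rintro ⟨w, hw, hwz⟩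
    rw [OnePoint.coe_eq_coe] at hwz
    rw [← hwz]
    exact mem_closedBall_iff_norm.mp hw

/-- The power of `γ_a z` with respect to the circle `∂D_a`, in terms of the power of `z` with
respect to the circle `∂D_ā`. -/
lemma power_moebiusC (a : Fin (2 * r)) {z : ℂ} (hz : mC (S.γ a) * z + mD (S.γ a) ≠ 0) :
    (S.radius a ^ 2 - ‖moebiusC (S.γ a) z - S.center a‖ ^ 2) * S.radius (bar a) =
      S.radius a * (‖z - S.center (bar a)‖ ^ 2 - S.radius (bar a) ^ 2) /
        ‖mC (S.γ a) * z + mD (S.γ a)‖ ^ 2 := by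
  set A := (S.γ a).1 0 0 with hA
  set B := (S.γ a).1 0 1 with hB
  set C := (S.γ a).1 1 0 with hC
  set E := (S.γ a).1 1 1 with hE
  set p := S.center a with hp
  set R := S.radius a with hR
  set p' := S.center (bar a) with hp'
  set R' := S.radius (bar a) with hR'
  have hRpos : 0 < R := S.radius_pos a
  have hR'pos : 0 < R' := S.radius_pos (bar a)
  have hdet : A * E - B * C = 1 := SL2R.det_eq _
  have hform : ∀ z : ℂ, mC (S.γ a) * z + mD (S.γ a) ≠ 0 →
      (R ^ 2 - ‖moebiusC (S.γ a) z - p‖ ^ 2) * ‖mC (S.γ a) * z + mD (S.γ a)‖ ^ 2 =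
      (R ^ 2 * C ^ 2 - (A - p * C) ^ 2) * ‖z‖ ^ 2 +
      2 * (R ^ 2 * C * E - (A - p * C) * (B - p * E)) * z.re +
      (R ^ 2 * E ^ 2 - (B - p * E) ^ 2) := by
    intro z hz
    have h1 : ‖moebiusC (S.γ a) z - p‖ ^ 2 * ‖mC (S.γ a) * z + mD (S.γ a)‖ ^ 2 =
        ‖(mA (S.γ a) * z + mB (S.γ a)) - p * (mC (S.γ a) * z + mD (S.γ a))‖ ^ 2 := by
      rw [← mul_pow, ← norm_mul, moebiusC, sub_mul, div_mul_cancel₀ _ hz]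
    rw [sub_mul, h1]
    simp only [← Complex.normSq_eq_norm_sq, Complex.normSq_apply, mA, mB, mC, mD,
      ← hA, ← hB, ← hC, ← hE]
    simp
    ring
  have hreal : ∀ x : ℝ, mC (S.γ a) * (x : ℂ) + mD (S.γ a) = ((C * x + E : ℝ) : ℂ) := by
    intro x; simp [mC, mD, hC, hE]
  have hnorm : ∀ x : ℝ, ‖(x : ℂ) - p'‖ = |x - p'| := by
    intro x
    rw [← Complex.ofReal_sub, Complex.norm_real, Real.norm_eq_abs]
  have hquad := quadratic_eq_of_sign (α := R ^ 2 * C ^ 2 - (A - p * C) ^ 2)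
    (β := 2 * (R ^ 2 * C * E - (A - p * C) * (B - p * E)))
    (δ := R ^ 2 * E ^ 2 - (B - p * E) ^ 2) (c := p') (R := R') hR'pos
    (by
      intro x hx
      have hne := S.denom_ne_zero a (z := (x : ℂ)) (by rw [hnorm]; exact hx)
      have hmem := (S.moebiusC_mem_iff a hne).mpr (by rw [hnorm]; exact hx)
      have hf := hform x hne
      simp only [Complex.norm_real, Real.norm_eq_abs, sq_abs, Complex.ofReal_re] at hf
      rw [← hf]
      have := pow_le_pow_left₀ (norm_nonneg _) hmem 2
      exact mul_nonneg (by linarith) (by positivity))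
    (by
      intro x hx
      by_cases hne : mC (S.γ a) * (x : ℂ) + mD (S.γ a) = 0
      · rw [hreal] at hne
        have hne' : C * x + E = 0 := by exact_mod_cast hne
        have hE' : E = -(C * x) := by linarith
        have hq : (R ^ 2 * C ^ 2 - (A - p * C) ^ 2) * x ^ 2 +
            2 * (R ^ 2 * C * E - (A - p * C) * (B - p * E)) * x +
            (R ^ 2 * E ^ 2 - (B - p * E) ^ 2) = -(A * x + B) ^ 2 := by
          rw [hE']; ring
        rw [hq]
        have : A * x + B ≠ 0 := by
          intro h0
          rw [hE'] at hdet
          have : (1 : ℝ) = 0 := by linear_combination -hdet - C * h0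
          exact one_ne_zero this
        have := sq_pos_of_ne_zero this
        linarith
      · have hmem := (S.moebiusC_mem_iff a hne).not.mpr
          (by rw [hnorm]; exact not_le.mpr hx)
        have hf := hform x hne
        simp only [Complex.norm_real, Real.norm_eq_abs, sq_abs, Complex.ofReal_re] at hf
        rw [← hf]
        have := pow_lt_pow_left₀ (not_le.mp hmem) hRpos.le two_ne_zero
        exact mul_neg_of_neg_of_pos (by linarith) (by positivity))
  obtain ⟨hα, hβ, hδ⟩ := hquad
  set α := R ^ 2 * C ^ 2 - (A - p * C) ^ 2 with hαdef
  have hα2 : α * R' = R := by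
    have h1 : (α * R') ^ 2 = R ^ 2 := by
      have hd : (2 * (R ^ 2 * C * E - (A - p * C) * (B - p * E))) ^ 2 -
          4 * α * (R ^ 2 * E ^ 2 - (B - p * E) ^ 2) = 4 * R ^ 2 := by
        have : (2 * (R ^ 2 * C * E - (A - p * C) * (B - p * E))) ^ 2 -
          4 * α * (R ^ 2 * E ^ 2 - (B - p * E) ^ 2) = 4 * R ^ 2 * (A * E - B * C) ^ 2 := by
          rw [hαdef]; ring
        rw [this, hdet]; ring
      rw [hβ, hδ] at hd
      linear_combination hd / 4
    exact (pow_left_inj₀ (by positivity) hRpos.le two_ne_zero).mp h1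
  have hn : 0 < ‖mC (S.γ a) * z + mD (S.γ a)‖ ^ 2 := by positivity
  rw [eq_div_iff hn.ne']
  have hf := hform z hz
  have hzp : ‖z - p'‖ ^ 2 = ‖z‖ ^ 2 - 2 * p' * z.re + p' ^ 2 := by
    simp only [← Complex.normSq_eq_norm_sq, Complex.normSq_apply]
    simp
    ring
  rw [hβ, hδ] at hf
  rw [hzp]
  linear_combination R' * hf + (‖z‖ ^ 2 - 2 * p' * z.re + p' ^ 2 - R' ^ 2) * hα2

end Schottky

lemma moebiusC_im (g : SL2R) (z : ℂ) :
    (moebiusC g z).im = z.im / ‖mC g * z + mD g‖ ^ 2 := by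
  have hdet := SL2R.det_eq g
  rw [moebiusC, Complex.div_im, ← Complex.normSq_eq_norm_sq, ← sub_div]
  congr 1
  simp [mA, mB, mC, mD]
  linear_combination z.im * hdet

lemma IsLogBranch.norm_exp_le {g : SL2R} {c R : ℝ} (hR : 0 < R)
    (hg : ∀ z ∈ closedBall (c : ℂ) R, mC g * z + mD g ≠ 0) :
    ∃ C : ℝ, ∀ ℓ : ℂ → ℂ, IsLogBranch g (closedBall (c : ℂ) R) ℓ →
      ∀ z ∈ closedBall (c : ℂ) R, ∀ h ∈ Ioc (0 : ℝ) 1, ∀ ν ∈ Icc (0 : ℝ) (1 / 2),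
        ‖Complex.exp ((1 / 2 - ν + I / h) * ℓ z)‖ ≤ Real.exp (C + C * |z.im| / h) := by
  have hcont : ContinuousOn (fun z : ℂ => (mC g * z + mD g)⁻¹) (closedBall (c : ℂ) R) :=
    ContinuousOn.inv₀ (by fun_prop) hg
  obtain ⟨B, hB⟩ := (isCompact_closedBall (c : ℂ) R).exists_bound_of_continuousOn hcont
  have hB0 : 0 ≤ B := (norm_nonneg _).trans (hB c (by simp [hR.le]))
  refine ⟨B ^ 2 + 2 * ‖mC g‖ * B, fun ℓ hℓ z hz h hh ν hν => ?_⟩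
  set L := 2 * ‖mC g‖ * B with hL
  have hL0 : 0 ≤ L := by positivity
  have hder : ∀ w ∈ closedBall (c : ℂ) R,
      HasDerivWithinAt ℓ (-2 * mC g * (mC g * w + mD g)⁻¹) (closedBall (c : ℂ) R) w := by
    intro w hw
    have h1 := (hℓ.holo w hw).hasDerivWithinAt
    have h2 := h1.cexp
    have h3 : HasDerivAt (dMob g) (-2 * mC g * (mC g * w + mD g)⁻¹ * dMob g w) w := by
      have h4 : HasDerivAt (fun z : ℂ => mC g * z + mD g) (mC g) w := by
        simpa using ((hasDerivAt_id w).const_mul (mC g)).add_const (mD g)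
      have h5 : HasDerivAt (dMob g) _ w := (h4.fun_inv (hg w hw)).fun_pow 2
      refine h5.congr_deriv ?_
      have := hg w hw
      simp only [dMob]
      norm_num
      field_simp
    have h6 := (h3.hasDerivWithinAt (s := closedBall (c : ℂ) R)).congr
      (fun x hx => hℓ.exp_eq x hx) (hℓ.exp_eq w hw)
    have huniq : UniqueDiffWithinAt ℂ (closedBall (c : ℂ) R) w := by
      refine uniqueDiffWithinAt_convex_of_isRCLikeNormedField (convex_closedBall _ _) ?_ ?_
      · rw [interior_closedBall _ hR.ne']
        exact ⟨c, mem_ball_self hR⟩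
      · exact subset_closure hw
    have h7 := huniq.eq_deriv _ h2 h6
    rw [← hℓ.exp_eq w hw, mul_comm] at h7
    rw [← mul_right_cancel₀ (Complex.exp_ne_zero _) h7]
    exact h1
  have hx : ((z.re : ℝ) : ℂ) ∈ closedBall (c : ℂ) R := by
    rw [mem_closedBall_iff_norm] at hz ⊢
    refine le_trans ?_ hz
    rw [← Complex.ofReal_sub, Complex.norm_real, Real.norm_eq_abs]
    simpa using Complex.abs_re_le_norm (z - c)
  have hlip := Convex.norm_image_sub_le_of_norm_hasDerivWithin_le (C := L) hder
    (fun w hw => by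
      rw [norm_mul, norm_mul, hL]
      have := hB w hw
      have h2 : ‖(-2 : ℂ)‖ = 2 := by simp
      rw [h2]
      gcongr) (convex_closedBall _ _) hx hz
  have him : |(ℓ z).im| ≤ L * |z.im| := by
    have h1 := Complex.abs_im_le_norm (ℓ z - ℓ (z.re : ℂ))
    rw [Complex.sub_im, hℓ.real_on _ hx, sub_zero] at h1
    refine h1.trans (hlip.trans_eq ?_)
    congr 1
    have : z - (z.re : ℂ) = I * (z.im : ℂ) := by apply Complex.ext <;> simp
    rw [this]
    simp
  have hre : (ℓ z).re ≤ B ^ 2 := by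
    have h1 : Real.exp (ℓ z).re ≤ B ^ 2 := by
      rw [← Complex.norm_exp, hℓ.exp_eq z hz, dMob, norm_pow]
      exact pow_le_pow_left₀ (norm_nonneg _) (hB z hz) 2
    linarith [Real.add_one_le_exp (ℓ z).re]
  rw [Complex.norm_exp]
  apply Real.exp_le_exp.mpr
  have hs : ((1 / 2 - ν + I / h) * ℓ z).re = (1 / 2 - ν) * (ℓ z).re - (ℓ z).im / h := by
    have : (1 / 2 - (ν : ℂ) + I / h) = ((1 / 2 - ν : ℝ) : ℂ) + ((1 / h : ℝ) : ℂ) * I := by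
      push_cast; ring
    rw [this, Complex.mul_re]
    simp
    ring
  rw [hs]
  have e1 : (1 / 2 - ν) * (ℓ z).re ≤ B ^ 2 := by
    have := mul_le_mul_of_nonneg_left hre (by linarith [hν.2] : 0 ≤ 1 / 2 - ν)
    nlinarith [hν.1, sq_nonneg B]
  have e2 : -(ℓ z).im / h ≤ (B ^ 2 + L) * |z.im| / h := by
    apply div_le_div_of_nonneg_right _ hh.1.le
    nlinarith [neg_le_abs (ℓ z).im, mul_nonneg (sq_nonneg B) (abs_nonneg z.im)]
  have e3 : -(ℓ z).im / h = -((ℓ z).im / h) := by ring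
  linarith

lemma Real.div_one_add_sq_le_arctan_sub_arctan {A B : ℝ} (hB : 0 ≤ B) (hBA : B ≤ A) :
    (A - B) / (1 + A ^ 2) ≤ Real.arctan A - Real.arctan B := by
  have := (convex_Icc B A).mul_sub_le_image_sub_of_le_deriv (f := Real.arctan)
    (C := (1 + A ^ 2)⁻¹) Real.continuous_arctan.continuousOn
    Real.differentiable_arctan.differentiableOn (fun x hx => by
      rw [interior_Icc] at hx
      simp only [Real.deriv_arctan, one_div]
      have : x ^ 2 ≤ A ^ 2 := pow_le_pow_left₀ (hB.trans hx.1.le) hx.2.le 2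
      gcongr) B (left_mem_Icc.mpr hBA) A (right_mem_Icc.mpr hBA) hBA
  rwa [inv_mul_eq_div] at this

lemma exists_pos_forall_of_finite {ι : Type*} [Finite ι] {P : ι → ℝ → Prop}
    (h : ∀ i, ∃ c > 0, ∀ c', 0 < c' → c' ≤ c → P i c') : ∃ c > 0, ∀ i, P i c := by
  have h1 : ∀ᶠ c in nhdsWithin (0 : ℝ) (Ioi 0), ∀ i, P i c := by
    rw [Filter.eventually_all]
    intro i
    obtain ⟨c, hc, hP⟩ := h i
    filter_upwards [Ioc_mem_nhdsGT hc] with x hx using hP x hx.1 hx.2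
  obtain ⟨c, h2, h3⟩ := (h1.and self_mem_nhdsWithin).exists
  exact ⟨c, h3, h2⟩

lemma exists_forall_of_finite {ι : Type*} [Finite ι] {P : ι → ℝ → Prop}
    (h : ∀ i, ∃ C, ∀ C' ≥ C, P i C') : ∃ C > 0, ∀ i, P i C := by
  have h1 : ∀ᶠ C in Filter.atTop, ∀ i, P i C := by
    rw [Filter.eventually_all]
    intro i
    obtain ⟨C, hP⟩ := h i
    filter_upwards [Filter.eventually_ge_atTop C] with x hx using hP x hx
  obtain ⟨C, h2, h3⟩ := (h1.and (Filter.eventually_gt_atTop 0)).exists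
  exact ⟨C, h3, h2⟩

lemma angleWeight_le {c R ρ : ℝ} (hR : 0 < R) (hρ : R < ρ) {z : ℂ}
    (hz : z ∈ closedBall (c : ℂ) R) :
    angleWeight c ρ z ≤ 2 * ρ / (ρ ^ 2 - R ^ 2) * |z.im| := by
  rw [mem_closedBall_iff_norm] at hz
  have h1 : 0 < ρ ^ 2 - R ^ 2 := by nlinarith
  have h2 : ‖z - c‖ ^ 2 ≤ R ^ 2 := pow_le_pow_left₀ (norm_nonneg _) hz 2
  have h3 : 0 < ρ := hR.trans hρ
  have harctan : ∀ x : ℝ, 0 ≤ x → Real.arctan x ≤ x := fun x hx => by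
    simpa only [Real.tan_arctan] using
      Real.le_tan (Real.arctan_nonneg.mpr hx) (Real.arctan_lt_pi_div_two x)
  refine (harctan _ (div_nonneg (by positivity) (by linarith))).trans ?_
  rw [div_mul_eq_mul_div]
  gcongr

namespace Schottky

variable {r : ℕ} (S : Schottky r)

lemma radius_add_radius_lt_dist {a b : Fin (2 * r)} (hab : a ≠ bar b) :
    S.radius b + S.radius (bar a) < ‖(S.center b : ℂ) - S.center (bar a)‖ := by
  have hne : b ≠ bar a := by
    rintro rfl
    exact hab (bar_bar a).symm
  rw [← dist_eq_norm]
  exact (disjoint_closedBall_closedBall_iff (S.radius_pos _).le (S.radius_pos _).le).mp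
    (S.disj hne)

lemma radius_lt_norm_sub {a b : Fin (2 * r)} (hab : a ≠ bar b) {z : ℂ} (hz : z ∈ S.disk b) :
    S.radius (bar a) < ‖z - S.center (bar a)‖ := by
  have h1 := S.radius_add_radius_lt_dist hab
  have h2 := mem_closedBall_iff_norm'.mp hz
  have h3 := norm_sub_le_norm_sub_add_norm_sub (S.center b : ℂ) z (S.center (bar a))
  linarith

lemma denom_ne_zero_of_mem {a b : Fin (2 * r)} (hab : a ≠ bar b) {z : ℂ} (hz : z ∈ S.disk b) :
    mC (S.γ a) * z + mD (S.γ a) ≠ 0 :=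
  S.denom_ne_zero a (S.radius_lt_norm_sub hab hz).le

lemma norm_moebiusC_sub_lt {a b : Fin (2 * r)} (hab : a ≠ bar b) {z : ℂ} (hz : z ∈ S.disk b) :
    ‖moebiusC (S.γ a) z - S.center a‖ < S.radius a := by
  have h0 := S.denom_ne_zero_of_mem hab hz
  have h1 := S.power_moebiusC a h0
  have h2 := S.radius_lt_norm_sub hab hz
  have hR := S.radius_pos a
  have hR' := S.radius_pos (bar a)
  have h3 : 0 < ‖z - S.center (bar a)‖ ^ 2 - S.radius (bar a) ^ 2 := by
    nlinarith
  have h4 : 0 < (S.radius a ^ 2 - ‖moebiusC (S.γ a) z - S.center a‖ ^ 2) * S.radius (bar a) := by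
    rw [h1]; positivity
  have h5 := pos_of_mul_pos_left h4 hR'.le
  exact lt_of_pow_lt_pow_left₀ 2 hR.le (by linarith)

lemma continuousOn_moebiusC {a b : Fin (2 * r)} (hab : a ≠ bar b) :
    ContinuousOn (moebiusC (S.γ a)) (S.disk b) :=
  ContinuousOn.div (by fun_prop) (by fun_prop) fun _ hz => S.denom_ne_zero_of_mem hab hz

lemma angleWeight_moebiusC_le {a b : Fin (2 * r)} (hab : a ≠ bar b) {ε : ℝ} (hε : 0 ≤ ε) {z : ℂ}
    (hz : z ∈ S.disk b) :
    angleWeight (S.center a) (S.radius a + ε) (moebiusC (S.γ a) z) ≤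
      Real.arctan (2 * S.radius (bar a) * |z.im| /
        (‖z - S.center (bar a)‖ ^ 2 - S.radius (bar a) ^ 2)) := by
  apply Real.arctan_mono
  have h0 := S.denom_ne_zero_of_mem hab hz
  have hlt := S.norm_moebiusC_sub_lt hab hz
  have hpow := S.power_moebiusC a h0
  have him := moebiusC_im (S.γ a) z
  have hR := S.radius_pos a
  have hR' := S.radius_pos (bar a)
  have hP : 0 < ‖z - S.center (bar a)‖ ^ 2 - S.radius (bar a) ^ 2 := by
    nlinarith [S.radius_lt_norm_sub hab hz]
  have hn : 0 < ‖mC (S.γ a) * z + mD (S.γ a)‖ ^ 2 := by positivity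
  rw [eq_div_iff hn.ne'] at hpow
  generalize ‖z - S.center (bar a)‖ ^ 2 - S.radius (bar a) ^ 2 = P at *
  generalize ‖mC (S.γ a) * z + mD (S.γ a)‖ ^ 2 = n at *
  have hs0 : 0 ≤ ‖moebiusC (S.γ a) z - S.center a‖ := norm_nonneg _
  generalize ‖moebiusC (S.γ a) z - S.center a‖ = s at *
  rw [him, abs_div, abs_of_pos hn]
  have hd1 : 0 < S.radius a ^ 2 - s ^ 2 := by nlinarith
  have hd2 : 0 < (S.radius a + ε) ^ 2 - s ^ 2 := by nlinarith
  have hy : 0 ≤ |z.im| := abs_nonneg _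
  have h1 : (S.radius a + ε) / ((S.radius a + ε) ^ 2 - s ^ 2) ≤
      S.radius a / (S.radius a ^ 2 - s ^ 2) := by
    rw [div_le_div_iff₀ hd2 hd1]
    have : 0 ≤ S.radius a * (S.radius a + ε) * ε + s ^ 2 * ε := by positivity
    linarith
  have h2 : S.radius a / (S.radius a ^ 2 - s ^ 2) = S.radius (bar a) * n / P := by
    rw [div_eq_div_iff hd1.ne' hP.ne']
    linarith
  rw [h2] at h1
  calc 2 * (S.radius a + ε) * (|z.im| / n) / ((S.radius a + ε) ^ 2 - s ^ 2)
      = 2 * (|z.im| / n) * ((S.radius a + ε) / ((S.radius a + ε) ^ 2 - s ^ 2)) := by ring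
    _ ≤ 2 * (|z.im| / n) * (S.radius (bar a) * n / P) := by gcongr
    _ = 2 * S.radius (bar a) * |z.im| / P := by field_simp

/-- The angle weights on slightly enlarged disks are contracted by the generators. -/
lemma exists_mul_im_le_angleWeight_sub {a b : Fin (2 * r)} (hab : a ≠ bar b) {ε : ℝ} (hε : 0 < ε)
    (hgap : S.radius b + ε + S.radius (bar a) < ‖(S.center b : ℂ) - S.center (bar a)‖) :
    ∃ κ > 0, ∀ z ∈ S.disk b, κ * |z.im| ≤ angleWeight (S.center b) (S.radius b + ε) z -
      angleWeight (S.center a) (S.radius a + ε) (moebiusC (S.γ a) z) := by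
  set ρ := S.radius b + ε with hρ
  set R := S.radius b with hR
  set R₁ := S.radius (bar a) with hR₁
  have hRpos : 0 < R := S.radius_pos b
  have hR₁pos : 0 < R₁ := S.radius_pos (bar a)
  have hRapos : 0 < S.radius a := S.radius_pos a
  have hρpos : 0 < ρ := by linarith
  set P₁ : ℂ → ℝ := fun z => ‖z - S.center (bar a)‖ ^ 2 - R₁ ^ 2 with hP₁
  set P₂ : ℂ → ℝ := fun z => ρ ^ 2 - ‖z - S.center b‖ ^ 2 with hP₂
  have hP₁pos : ∀ z ∈ S.disk b, 0 < P₁ z := fun z hz => by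
    have := S.radius_lt_norm_sub hab hz
    simp only [hP₁]
    nlinarith
  have hP₂pos : ∀ z ∈ S.disk b, 0 < P₂ z := fun z hz => by
    have h1 : ‖z - S.center b‖ ≤ R := mem_closedBall_iff_norm.mp hz
    simp only [hP₂]
    nlinarith [norm_nonneg (z - (S.center b : ℂ))]
  have hQ : ∀ z ∈ S.disk b, 0 < ρ * P₁ z - R₁ * P₂ z := fun z hz => by
    have h1 : ‖z - S.center b‖ ≤ R := mem_closedBall_iff_norm.mp hz
    have h2 := norm_sub_le_norm_sub_add_norm_sub (S.center b : ℂ) z (S.center (bar a))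
    rw [norm_sub_rev (S.center b : ℂ) z] at h2
    simp only [hP₁, hP₂]
    set s := ‖z - S.center b‖ with hs
    set x := ‖z - S.center (bar a)‖ with hx
    have hs0 : 0 ≤ s := norm_nonneg _
    have hx1 : ρ - s + R₁ < x := by linarith
    have hsρ : s < ρ := by linarith
    have h3 : (ρ - s + R₁) ^ 2 < x ^ 2 := pow_lt_pow_left₀ hx1 (by linarith) two_ne_zero
    have h4 : ρ * (ρ - s + R₁) ^ 2 < ρ * x ^ 2 := mul_lt_mul_of_pos_left h3 hρpos
    have h5 : 0 ≤ (ρ - s) * (ρ * (ρ - s) + R₁ * (ρ - s)) := by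
      have : 0 ≤ ρ - s := by linarith
      positivity
    nlinarith
  have hcont : ContinuousOn (fun z : ℂ => 2 * (ρ * P₁ z - R₁ * P₂ z) / (P₁ z * P₂ z) /
      (1 + (2 * ρ * |z.im| / P₂ z) ^ 2)) (S.disk b) := by
    have c1 : Continuous P₁ := by fun_prop
    have c2 : Continuous P₂ := by fun_prop
    have c3 : Continuous fun z : ℂ => |z.im| := continuous_abs.comp Complex.continuous_im
    refine ContinuousOn.div (ContinuousOn.div (by fun_prop) (by fun_prop) ?_)
      (continuousOn_const.add ((ContinuousOn.div (by fun_prop) (by fun_prop) ?_).pow 2)) ?_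
    · intro z hz
      exact (mul_pos (hP₁pos z hz) (hP₂pos z hz)).ne'
    · intro z hz
      exact (hP₂pos z hz).ne'
    · intro z _
      positivity
  obtain ⟨κ, hκ, hmin⟩ := (isCompact_closedBall (S.center b : ℂ) R).exists_forall_le' hcont
    (a := 0) (fun z hz => by
      have h1 := hP₁pos z hz
      have h2 := hP₂pos z hz
      have h3 := hQ z hz
      positivity)
  refine ⟨κ, hκ, fun z hz => ?_⟩
  have h1 := hP₁pos z hz
  have h2 := hP₂pos z hz
  have h3 := hQ z hz
  have h0 := S.denom_ne_zero_of_mem hab hz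
  set A := 2 * ρ * |z.im| / P₂ z with hA
  set B := 2 * R₁ * |z.im| / P₁ z with hB
  have hB0 : 0 ≤ B := by positivity
  have hAB : A - B = 2 * (ρ * P₁ z - R₁ * P₂ z) / (P₁ z * P₂ z) * |z.im| := by
    rw [hA, hB]
    field_simp
  have hBA : B ≤ A := by
    rw [← sub_nonneg, hAB]
    positivity
  have hW : angleWeight (S.center a) (S.radius a + ε) (moebiusC (S.γ a) z) ≤ Real.arctan B :=
    S.angleWeight_moebiusC_le hab hε.le hz
  have hmain := Real.div_one_add_sq_le_arctan_sub_arctan hB0 hBA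
  have hκz := mul_le_mul_of_nonneg_right (hmin z hz) (abs_nonneg z.im)
  have heq : (A - B) / (1 + A ^ 2) = 2 * (ρ * P₁ z - R₁ * P₂ z) / (P₁ z * P₂ z) /
      (1 + (2 * ρ * |z.im| / P₂ z) ^ 2) * |z.im| := by
    rw [hAB, ← hA]
    ring
  have hdef : angleWeight (S.center b) ρ z = Real.arctan A := rfl
  rw [hdef]
  linarith

end Schottky

namespace Schottky

variable {r : ℕ} (S : Schottky r)

lemma exists_gap : ∃ ε > 0, ∀ a b : Fin (2 * r), a ≠ bar b →
    S.radius b + ε + S.radius (bar a) < ‖(S.center b : ℂ) - S.center (bar a)‖ := by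
  obtain ⟨ε, hε, h⟩ := exists_pos_forall_of_finite (ι := Fin (2 * r) × Fin (2 * r))
    (P := fun p ε => p.1 ≠ bar p.2 → S.radius p.2 + ε + S.radius (bar p.1) <
      ‖(S.center p.2 : ℂ) - S.center (bar p.1)‖) (fun p => by
        by_cases hp : p.1 = bar p.2
        · exact ⟨1, one_pos, fun _ _ _ h => absurd hp h⟩
        · have := S.radius_add_radius_lt_dist hp
          exact ⟨(‖(S.center p.2 : ℂ) - S.center (bar p.1)‖ -
            (S.radius p.2 + S.radius (bar p.1))) / 2, by linarith,
            fun c _ hc _ => by linarith⟩)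
  exact ⟨ε, hε, fun a b => h (a, b)⟩

lemma exists_norm_moebiusC_sub_le : ∃ δ > 0, ∀ a b : Fin (2 * r), a ≠ bar b →
    ∀ z ∈ S.disk b, ‖moebiusC (S.γ a) z - S.center a‖ ≤ (1 - δ) * S.radius a := by
  obtain ⟨δ, hδ, h⟩ := exists_pos_forall_of_finite (ι := Fin (2 * r) × Fin (2 * r))
    (P := fun p δ => p.1 ≠ bar p.2 → ∀ z ∈ S.disk p.2,
      ‖moebiusC (S.γ p.1) z - S.center p.1‖ ≤ (1 - δ) * S.radius p.1) (fun p => by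
        by_cases hp : p.1 = bar p.2
        · exact ⟨1, one_pos, fun _ _ _ h => absurd hp h⟩
        · obtain ⟨d, hd, hmin⟩ := (isCompact_closedBall (S.center p.2 : ℂ)
            (S.radius p.2)).exists_forall_le'
            (f := fun z => S.radius p.1 - ‖moebiusC (S.γ p.1) z - S.center p.1‖) (a := 0)
            (continuousOn_const.sub ((S.continuousOn_moebiusC hp).sub continuousOn_const).norm)
            (fun z hz => sub_pos.mpr (S.norm_moebiusC_sub_lt hp hz))
          have hR := S.radius_pos p.1
          refine ⟨d / S.radius p.1, by positivity, fun c _ hc _ z hz => ?_⟩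
          have h1 := hmin z hz
          rw [le_div_iff₀ hR] at hc
          linarith)
  exact ⟨δ, hδ, fun a b => h (a, b)⟩

lemma exists_uniform_contraction {ε : ℝ} (hε : 0 < ε) (hgap : ∀ a b : Fin (2 * r), a ≠ bar b →
    S.radius b + ε + S.radius (bar a) < ‖(S.center b : ℂ) - S.center (bar a)‖) :
    ∃ κ > 0, ∀ a b : Fin (2 * r), a ≠ bar b → ∀ z ∈ S.disk b,
      κ * |z.im| ≤ angleWeight (S.center b) (S.radius b + ε) z -
        angleWeight (S.center a) (S.radius a + ε) (moebiusC (S.γ a) z) := by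
  obtain ⟨κ, hκ, h⟩ := exists_pos_forall_of_finite (ι := Fin (2 * r) × Fin (2 * r))
    (P := fun p κ => p.1 ≠ bar p.2 → ∀ z ∈ S.disk p.2,
      κ * |z.im| ≤ angleWeight (S.center p.2) (S.radius p.2 + ε) z -
        angleWeight (S.center p.1) (S.radius p.1 + ε) (moebiusC (S.γ p.1) z)) (fun p => by
        by_cases hp : p.1 = bar p.2
        · exact ⟨1, one_pos, fun _ _ _ h => absurd hp h⟩
        · obtain ⟨κ, hκ, h⟩ := S.exists_mul_im_le_angleWeight_sub hp hε (hgap _ _ hp)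
          exact ⟨κ, hκ, fun c _ hc _ z hz =>
            (mul_le_mul_of_nonneg_right hc (abs_nonneg _)).trans (h z hz)⟩)
  exact ⟨κ, hκ, fun a b => h (a, b)⟩

lemma exists_norm_exp_le : ∃ C > 0, ∀ a b : Fin (2 * r), a ≠ bar b →
    ∀ ℓ, IsLogBranch (S.γ a) (S.disk b) ℓ → ∀ z ∈ S.disk b,
    ∀ h ∈ Ioc (0 : ℝ) 1, ∀ ν ∈ Icc (0 : ℝ) (1 / 2),
      ‖Complex.exp ((1 / 2 - ν + I / h) * ℓ z)‖ ≤ Real.exp (C + C * |z.im| / h) := by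
  obtain ⟨C, hC, h⟩ := exists_forall_of_finite (ι := Fin (2 * r) × Fin (2 * r))
    (P := fun p C => p.1 ≠ bar p.2 → ∀ ℓ, IsLogBranch (S.γ p.1) (S.disk p.2) ℓ →
      ∀ z ∈ S.disk p.2, ∀ h ∈ Ioc (0 : ℝ) 1, ∀ ν ∈ Icc (0 : ℝ) (1 / 2),
      ‖Complex.exp ((1 / 2 - ν + I / h) * ℓ z)‖ ≤ Real.exp (C + C * |z.im| / h)) (fun p => by
        by_cases hp : p.1 = bar p.2
        · exact ⟨1, fun _ _ h => absurd hp h⟩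
        · obtain ⟨C, hC⟩ := IsLogBranch.norm_exp_le (S.radius_pos p.2)
            fun z hz => S.denom_ne_zero_of_mem hp hz
          refine ⟨C, fun C' hC' _ ℓ hℓ z hz h hh ν hν => (hC ℓ hℓ z hz h hh ν hν).trans ?_⟩
          have := hh.1
          gcongr)
  exact ⟨C, hC, fun a b => h (a, b)⟩

lemma exists_angleWeight_le {ε : ℝ} (hε : 0 < ε) : ∃ C > 0, ∀ b : Fin (2 * r), ∀ z ∈ S.disk b,
    angleWeight (S.center b) (S.radius b + ε) z ≤ C * |z.im| := by
  obtain ⟨C, hC, h⟩ := exists_forall_of_finite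
    (P := fun b C => ∀ z ∈ S.disk b,
      angleWeight (S.center b) (S.radius b + ε) z ≤ C * |z.im|) (fun b =>
        ⟨_, fun C' hC' z hz => (angleWeight_le (S.radius_pos b)
          (lt_add_of_pos_right _ hε) hz).trans
          (mul_le_mul_of_nonneg_right hC' (abs_nonneg _))⟩)
  exact ⟨C, hC, h⟩

lemma disk_subset_D (b : Fin (2 * r)) : S.disk b ⊆ S.D := subset_iUnion S.disk b

lemma ball_subset_interior_D (b : Fin (2 * r)) :
    ball (S.center b : ℂ) (S.radius b) ⊆ interior S.D :=
  interior_maximal (ball_subset_closedBall.trans (S.disk_subset_D b)) isOpen_ball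

lemma isCompact_D : IsCompact S.D := isCompact_iUnion fun _ => isCompact_closedBall _ _

lemma moebiusC_mem_disk {a b : Fin (2 * r)} (hab : a ≠ bar b) {z : ℂ} (hz : z ∈ S.disk b) :
    moebiusC (S.γ a) z ∈ S.disk a :=
  mem_closedBall_iff_norm.mpr (S.norm_moebiusC_sub_lt hab hz).le

lemma norm_le_sSup_Ire {u : ℂ → ℂ} (hu : ContinuousOn u S.D) {x : ℝ} (hx : (x : ℂ) ∈ S.D) :
    ‖u x‖ ≤ sSup ((fun x : ℝ => ‖u ((x : ℝ) : ℂ)‖) '' S.Ire) := by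
  refine le_csSup ((S.isCompact_D.bddAbove_image hu.norm).mono ?_) ⟨x, hx, rfl⟩
  rintro _ ⟨y, hy, rfl⟩
  exact ⟨y, hy, rfl⟩

/-- The fixed-point equation extends from the open disks to the closed disks by continuity. -/
lemma transferFixed_eq {s : ℂ} {ℓ : Fin (2 * r) → Fin (2 * r) → ℂ → ℂ}
    (hℓ : IsBranchFamily S ℓ) {u : ℂ → ℂ} (hu : ContinuousOn u S.D)
    (hfix : TransferFixed S s ℓ u) (b : Fin (2 * r)) {z : ℂ} (hz : z ∈ S.disk b) :
    u z = ∑ a : Fin (2 * r), if a ≠ bar b then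
      Complex.exp (s * ℓ a b z) * u (moebiusC (S.γ a) z) else 0 := by
  have hcl : S.disk b ⊆ closure (ball (S.center b : ℂ) (S.radius b)) := by
    rw [closure_ball _ (S.radius_pos b).ne']
    exact subset_rfl
  refine Set.EqOn.of_subset_closure (f := u) (g := fun z => ∑ a : Fin (2 * r), if a ≠ bar b then
    Complex.exp (s * ℓ a b z) * u (moebiusC (S.γ a) z) else 0)
    (s := ball (S.center b : ℂ) (S.radius b)) (t := S.disk b) ?_
    (hu.mono (S.disk_subset_D b)) ?_ ball_subset_closedBall hcl hz
  · intro w hw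
    exact hfix b w (interior_maximal ball_subset_closedBall isOpen_ball hw)
  · refine continuousOn_finsetSum _ fun a _ => ?_
    by_cases hab : a = bar b
    · simpa [hab] using continuousOn_const
    · simp only [ne_eq, hab, not_false_eq_true, if_true]
      refine ContinuousOn.mul ?_ ?_
      · exact (continuousOn_const.mul (hℓ a b hab).holo.continuousOn).cexp
      · exact (hu.mono (S.disk_subset_D a)).comp (S.continuousOn_moebiusC hab)
          fun w hw => S.moebiusC_mem_disk hab hw

end Schottky

/-- A priori bound: there are `K ≥ 10` and `C > 0` depending only on the
Schottky data such that for `s = 1/2 − ν + i/h` and any `u` continuous on `D`, holomorphic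
on its interior with `L_s u = u`, one has `sup_D e^{−K|Im z|/h}|u| ≤ C sup_I |u|`. -/
theorem stmt12 {r : ℕ} (S : Schottky r) :
    ∃ K C : ℝ, 10 ≤ K ∧ 0 < C ∧
      ∀ h ∈ Set.Ioc (0 : ℝ) 1, ∀ ν ∈ Set.Icc (0 : ℝ) (1 / 2),
      ∀ ℓ : Fin (2 * r) → Fin (2 * r) → ℂ → ℂ, IsBranchFamily S ℓ →
      ∀ u : ℂ → ℂ, ContinuousOn u S.D → DifferentiableOn ℂ u (interior S.D) →
        TransferFixed S (1 / 2 - ν + I / h) ℓ u →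
      ∀ z ∈ S.D,
        Real.exp (-K * |z.im| / h) * ‖u z‖
          ≤ C * sSup ((fun x : ℝ => ‖u ((x : ℝ) : ℂ)‖) '' S.Ire) := by
  classical
  obtain ⟨ε, hε, hgap⟩ := S.exists_gap
  obtain ⟨δ, hδ, hcontr⟩ := S.exists_norm_moebiusC_sub_le
  obtain ⟨κ, hκ, hW⟩ := S.exists_uniform_contraction hε hgap
  obtain ⟨C, hC, hexp⟩ := S.exists_norm_exp_le
  obtain ⟨C₂, hC₂, hW₂⟩ := S.exists_angleWeight_le hε
  have : Nonempty (Fin (2 * r)) := ⟨⟨0, by have := S.hr; omega⟩⟩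
  have hr : (0 : ℝ) < r := by exact_mod_cast S.hr
  set W : Fin (2 * r) → ℂ → ℝ := fun b => angleWeight (S.center b) (S.radius b + ε) with hWdef
  obtain ⟨n, hn⟩ : ∃ n : ℕ, (1 - δ / 2) ^ n < 1 / (2 * (2 * r) * Real.exp C) :=
    exists_pow_lt_of_lt_one (by positivity) (by linarith)
  set q := 1 - δ / 2 with hq
  have hq0 : 0 ≤ q := by
    have a := Classical.arbitrary (Fin (2 * r))
    obtain ⟨b, hb⟩ : ∃ b : Fin (2 * r), a ≠ bar b := by
      refine ⟨a, fun h => ?_⟩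
      have h1 := congrArg Fin.val h
      have := S.hr
      simp only [bar] at h1
      split_ifs at h1 <;> simp at h1 <;> omega
    have h1 := hcontr a b hb (S.center b) (mem_closedBall_self (S.radius_pos b).le)
    have h2 := nonneg_of_mul_nonneg_left ((norm_nonneg _).trans h1) (S.radius_pos a)
    linarith
  refine ⟨max 10 (C / κ * C₂), (2 / δ) ^ n, le_max_left _ _, by positivity, ?_⟩
  intro h hh ν hν ℓ hℓ u hu hd hfix z hz
  have hh0 : 0 < h := hh.1
  set m := sSup ((fun x : ℝ => ‖u ((x : ℝ) : ℂ)‖) '' S.Ire) with hm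
  have hm0 : 0 ≤ m := Real.sSup_nonneg (by rintro _ ⟨x, -, rfl⟩; exact norm_nonneg _)
  set k := C / κ / h with hk
  have hk0 : 0 < k := by positivity
  have hkκ : k * κ = C / h := by rw [hk]; field_simp
  set f : Fin (2 * r) → ℂ → ℝ := fun b z => Real.exp (-(k * W b z)) * ‖u z‖ with hf
  have hfcont : ∀ b, ContinuousOn (f b) (S.disk b) := fun b =>
    ((continuousOn_angleWeight (S.radius_pos b)
      (lt_add_of_pos_right _ hε)).const_mul k).neg.rexp.mul (hu.mono (S.disk_subset_D b)).norm
  have hmax : ∀ b, ∃ w ∈ S.disk b, IsMaxOn (f b) (S.disk b) w := fun b =>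
    (isCompact_closedBall _ _).exists_isMaxOn
      ⟨_, mem_closedBall_self (S.radius_pos b).le⟩ (hfcont b)
  choose p hp hpmax using hmax
  obtain ⟨b, hb⟩ := Finite.exists_max fun b => f b (p b)
  set M := f b (p b) with hM
  have hMle : ∀ a, ∀ w ∈ S.disk a, f a w ≤ M := fun a w hw => (hpmax a hw).trans (hb a)
  have hM0 : 0 ≤ M := by positivity
  set X := m * (2 / δ) ^ n with hX
  have hX0 : 0 ≤ X := by positivity
  have hterm : ∀ a, a ≠ bar b → Real.exp (-(k * W b (p b))) *
      ‖Complex.exp ((1 / 2 - ν + I / h) * ℓ a b (p b)) * u (moebiusC (S.γ a) (p b))‖ ≤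
      Real.exp C * (max M X * q ^ n) := by
    intro a hab
    have hR := S.radius_pos a
    set w := moebiusC (S.γ a) (p b) with hw
    have hc := hcontr a b hab (p b) (hp b)
    have h1 := norm_mul_exp_angleWeight_le (c := S.center a) (k := k) (M := M) (m := m)
      (t := δ / 2 * S.radius a) n hR (lt_add_of_pos_right _ hε) (by positivity)
      (hu.mono (S.disk_subset_D a)) (hd.mono (S.ball_subset_interior_D a)) (hMle a)
      (fun x hx => S.norm_le_sSup_Ire hu (S.disk_subset_D a hx))
      (mem_ball_iff_norm.mpr (S.norm_moebiusC_sub_lt hab (hp b)))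
    have h2 : S.radius a / (δ / 2 * S.radius a) = 2 / δ := by field_simp
    have h3 : (‖w - S.center a‖ + δ / 2 * S.radius a) / S.radius a ≤ q := by
      rw [div_le_iff₀ hR, hq]
      linarith
    rw [h2, ← hX] at h1
    have h4 : Real.exp (-(k * W a w)) * ‖u w‖ ≤ max M X * q ^ n := by
      refine h1.trans ?_
      gcongr
    have h5 := hexp a b hab _ (hℓ a b hab) (p b) (hp b) h hh ν hν
    have h6 : C * |(p b).im| / h ≤ k * W b (p b) - k * W a w := by
      have := mul_le_mul_of_nonneg_left (hW a b hab (p b) (hp b)) hk0.le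
      rw [← mul_assoc, hkκ, mul_sub] at this
      rwa [mul_div_right_comm]
    rw [norm_mul]
    calc Real.exp (-(k * W b (p b))) *
          (‖Complex.exp ((1 / 2 - ν + I / h) * ℓ a b (p b))‖ * ‖u w‖)
        ≤ Real.exp (-(k * W b (p b))) * (Real.exp (C + C * |(p b).im| / h) * ‖u w‖) := by
          gcongr
      _ = Real.exp (-(k * W b (p b)) + (C + C * |(p b).im| / h)) * ‖u w‖ := by
          rw [← mul_assoc, ← Real.exp_add]
      _ ≤ Real.exp (C + -(k * W a w)) * ‖u w‖ := by
          gcongr ?_ * _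
          exact Real.exp_le_exp.mpr (by linarith)
      _ = Real.exp C * (Real.exp (-(k * W a w)) * ‖u w‖) := by
          rw [Real.exp_add, mul_assoc]
      _ ≤ _ := by gcongr
  have hhalf : M ≤ max M X / 2 := by
    have hY : 0 ≤ max M X := le_max_of_le_left hM0
    have h1 : M ≤ ∑ _a : Fin (2 * r), Real.exp C * (max M X * q ^ n) := by
      have hMeq : M = Real.exp (-(k * W b (p b))) * ‖∑ a : Fin (2 * r), if a ≠ bar b then
          Complex.exp ((1 / 2 - ν + I / h) * ℓ a b (p b)) * u (moebiusC (S.γ a) (p b))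
          else 0‖ := by
        rw [← S.transferFixed_eq hℓ hu hfix b (hp b)]
      refine hMeq.trans_le <| (mul_le_mul_of_nonneg_left (norm_sum_le _ _) (Real.exp_pos _).le).trans ?_
      rw [Finset.mul_sum]
      refine Finset.sum_le_sum fun a _ => ?_
      split_ifs with hab
      · exact hterm a hab
      · rw [norm_zero, mul_zero]
        positivity
    rw [Finset.sum_const, Finset.card_univ, Fintype.card_fin, nsmul_eq_mul] at h1
    push_cast at h1
    refine h1.trans ?_
    rw [lt_div_iff₀ (by positivity)] at hn
    calc 2 * (r : ℝ) * (Real.exp C * (max M X * q ^ n))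
        = max M X / 2 * (q ^ n * (2 * (2 * r) * Real.exp C)) := by ring
      _ ≤ max M X / 2 * 1 := by gcongr
      _ = max M X / 2 := mul_one _
  have hMX : M ≤ X := by
    by_contra! hlt
    rw [max_eq_left hlt.le] at hhalf
    linarith
  obtain ⟨a, hza⟩ := mem_iUnion.mp hz
  have h1 : -max 10 (C / κ * C₂) * |z.im| / h ≤ -(k * W a z) := by
    rw [neg_mul, neg_div, neg_le_neg_iff]
    calc k * W a z ≤ k * (C₂ * |z.im|) := by
          gcongr
          exact hW₂ a z hza
      _ = C / κ * C₂ * |z.im| / h := by rw [hk]; ring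
      _ ≤ _ := by
          gcongr
          exact le_max_right _ _
  calc Real.exp (-max 10 (C / κ * C₂) * |z.im| / h) * ‖u z‖
      ≤ f a z := by
        simp only [hf]
        gcongr
    _ ≤ M := hMle a z hza
    _ ≤ X := hMX
    _ = (2 / δ) ^ n * m := mul_comm _ _
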